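/- The Steiner-type symmetrization S preserves convexity: Let n, s be positive integers and let C ⊂ ℝ^{n+s} = ℝⁿ × ℝˢ be a bounded convex set. Then S(C) is convex. -/

import Mathlib

open MeasureTheory

/-- `ω_s`: the Lebesgue measure of the unit ball in `ℝˢ`. -/
noncomputable def unitBallVol (s : ℕ) : ℝ :=
  (volume (Metric.ball (0 : EuclideanSpace ℝ (Fin s)) 1)).toReal

/-- The section-radius function: `r_C(x̄) = (ω_s⁻¹ |C(x̄)|)^{1/s}`, where
`C(x̄) = {y ∈ ℝˢ : (x̄, y) ∈ C}`. -/
noncomputable def sectionRadius (n s : ℕ)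
    (C : Set (EuclideanSpace ℝ (Fin n) × EuclideanSpace ℝ (Fin s)))
    (x : EuclideanSpace ℝ (Fin n)) : ℝ :=
  ((unitBallVol s)⁻¹ * (volume {y | (x, y) ∈ C}).toReal) ^ (1 / (s : ℝ))

/-- The Steiner-type symmetrand
`S(C) = {(x̄,y) ∈ ℝⁿ × ℝˢ : C(x̄) ≠ ∅, |y| ≤ r_C(x̄)}`. -/
def Ssymm (n s : ℕ) (C : Set (EuclideanSpace ℝ (Fin n) × EuclideanSpace ℝ (Fin s))) :
    Set (EuclideanSpace ℝ (Fin n) × EuclideanSpace ℝ (Fin s)) :=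
  {z | {y | (z.1, y) ∈ C}.Nonempty ∧ ‖z.2‖ ≤ sectionRadius n s C z.1}

open scoped ENNReal Pointwise

theorem Real.volume_add_le_of_isCompact {K L C : Set ℝ} (hK : IsCompact K) (hL : IsCompact L)
    (hK' : K.Nonempty) (hL' : L.Nonempty) (h : ∀ x ∈ K, ∀ y ∈ L, x + y ∈ C) :
    volume K + volume L ≤ volume C := by
  obtain ⟨M, hM, hMmax⟩ := hK.exists_isGreatest hK'
  obtain ⟨m, hm, hmmin⟩ := hL.exists_isLeast hL'
  have hK1 : volume ((fun x => x + m) '' K) = volume K := by simp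
  have hL1 : volume ((fun x => M + x) '' L) = volume L := by simp
  have hinter : volume (((fun x => x + m) '' K) ∩ ((fun x => M + x) '' L)) = 0 := by
    refine measure_mono_null (t := {M + m}) ?_ (by simp)
    rintro _ ⟨⟨x, hx, rfl⟩, ⟨y, hy, hxy⟩⟩
    have := hMmax hx
    have := hmmin hy
    simp only [Set.mem_singleton_iff] at *
    linarith
  have hmeas : MeasurableSet ((fun x => M + x) '' L) :=
    (hL.image (by fun_prop)).measurableSet
  rw [← hK1, ← hL1, ← measure_union_add_inter _ hmeas, hinter, add_zero]
  refine measure_mono (Set.union_subset ?_ ?_)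
  · rintro _ ⟨x, hx, rfl⟩
    exact h x hx m hm
  · rintro _ ⟨y, hy, rfl⟩
    exact h M hM y hy

theorem Real.volume_add_le {A B C : Set ℝ} (hA : MeasurableSet A) (hB : MeasurableSet B)
    (hA' : A.Nonempty) (hB' : B.Nonempty) (h : ∀ x ∈ A, ∀ y ∈ B, x + y ∈ C) :
    volume A + volume B ≤ volume C := by
  obtain ⟨a, ha⟩ := hA'
  obtain ⟨b, hb⟩ := hB'
  have key : ∀ K ⊆ A, IsCompact K → ∀ L ⊆ B, IsCompact L → volume K + volume L ≤ volume C := by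
    intro K hKA hK L hLB hL
    have hcompact := Real.volume_add_le_of_isCompact (C := C) (hK.insert a) (hL.insert b)
      (Set.insert_nonempty _ _) (Set.insert_nonempty _ _)
      fun x hx y hy => h x (Set.insert_subset ha hKA hx) y (Set.insert_subset hb hLB hy)
    exact (add_le_add (measure_mono (Set.subset_insert _ _))
      (measure_mono (Set.subset_insert _ _))).trans hcompact
  rw [hA.measure_eq_iSup_isCompact, hB.measure_eq_iSup_isCompact]
  simp only [iSup_and']
  exact ENNReal.biSup_add_biSup_le' ⟨∅, by simp⟩ ⟨∅, by simp⟩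
    fun K hK L hL => key K hK.1 hK.2 L hL.1 hL.2

/-- The one-dimensional Prékopa–Leindler inequality in additive form, for functions with supremum
`1`. -/
theorem Real.lintegral_ofReal_add_le {p q : ℝ} (hp : 0 < p) (hq : 0 < q) {f g h : ℝ → ℝ}
    (hf : Measurable f) (hg : Measurable g) (hh : Measurable h)
    (hf0 : 0 ≤ f) (hg0 : 0 ≤ g) (hh0 : 0 ≤ h) (hf1 : ∀ x, f x ≤ 1) (hg1 : ∀ x, g x ≤ 1)
    (hfsup : ∀ u, 0 < u → u < 1 → ∃ x, u < f x) (hgsup : ∀ u, 0 < u → u < 1 → ∃ x, u < g x)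
    (hfgh : ∀ x y u, 0 < u → u < f x → u < g y → u < h (p * x + q * y)) :
    ENNReal.ofReal p * (∫⁻ x, ENNReal.ofReal (f x)) +
      ENNReal.ofReal q * (∫⁻ x, ENNReal.ofReal (g x)) ≤ ∫⁻ x, ENNReal.ofReal (h x) := by
  have hanti (F : ℝ → ℝ) : Measurable fun t => volume {a | t < F a} :=
    Antitone.measurable fun s t hst => measure_mono fun a (ha : t < F a) => hst.trans_lt ha
  rw [lintegral_eq_lintegral_meas_lt _ (ae_of_all _ hf0) hf.aemeasurable,
    lintegral_eq_lintegral_meas_lt _ (ae_of_all _ hg0) hg.aemeasurable,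
    lintegral_eq_lintegral_meas_lt _ (ae_of_all _ hh0) hh.aemeasurable,
    ← lintegral_const_mul _ (hanti f), ← lintegral_const_mul _ (hanti g),
    ← lintegral_add_left ((hanti f).const_mul _)]
  refine setLIntegral_mono' measurableSet_Ioi fun u (hu : 0 < u) => ?_
  rcases le_or_gt 1 u with hu1 | hu1
  · have hf' : {a | u < f a} = ∅ := Set.eq_empty_of_forall_notMem
      fun x (hx : u < f x) => (hx.trans_le (hf1 x)).not_ge hu1
    have hg' : {a | u < g a} = ∅ := Set.eq_empty_of_forall_notMem
      fun x (hx : u < g x) => (hx.trans_le (hg1 x)).not_ge hu1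
    simp [hf', hg']
  · have hfm : MeasurableSet {a | u < f a} := hf measurableSet_Ioi
    have hgm : MeasurableSet {a | u < g a} := hg measurableSet_Ioi
    have hscale (c : ℝ) (hc : 0 < c) (s : Set ℝ) :
        ENNReal.ofReal c * volume s = volume (c • s) := by
      rw [Measure.addHaar_smul]
      simp [abs_of_pos hc]
    rw [hscale p hp, hscale q hq]
    refine Real.volume_add_le (hfm.const_smul_of_ne_zero hp.ne')
      (hgm.const_smul_of_ne_zero hq.ne') (Set.Nonempty.smul_set (hfsup u hu hu1))
      (Set.Nonempty.smul_set (hgsup u hu hu1)) ?_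
    rintro _ ⟨x, hx, rfl⟩ _ ⟨y, hy, rfl⟩
    exact hfgh x y u hu hx hy

theorem ENNReal.geom_mean_le_arith_mean2 {p q : ℝ} (hp : 0 < p) (hq : 0 < q) (hpq : p + q = 1)
    (x y : ℝ≥0∞) : x ^ p * y ^ q ≤ ENNReal.ofReal p * x + ENNReal.ofReal q * y := by
  have hconj : p⁻¹.HolderConjugate q⁻¹ := by
    rw [Real.holderConjugate_iff, inv_inv, inv_inv]
    exact ⟨(one_lt_inv₀ hp).2 (by linarith), hpq⟩
  simpa [← ENNReal.rpow_mul, hp.ne', hq.ne', ENNReal.ofReal_inv_of_pos, hp, hq, div_eq_mul_inv,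
    mul_comm] using ENNReal.young_inequality (x ^ p) (y ^ q) hconj


theorem Real.prekopaLeindler_of_bounded {p q : ℝ} (hp : 0 < p) (hq : 0 < q) (hpq : p + q = 1)
    {f g h : ℝ → ℝ≥0∞} (hf : Measurable f) (hg : Measurable g) (hh : Measurable h)
    (hftop : ⨆ x, f x ≠ ∞) (hgtop : ⨆ x, g x ≠ ∞)
    (hfgh : ∀ x y, f x ^ p * g y ^ q ≤ h (p * x + q * y)) :
    (∫⁻ x, f x) ^ p * (∫⁻ x, g x) ^ q ≤ ∫⁻ x, h x := by
  set a := ⨆ x, f x with ha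
  set b := ⨆ x, g x with hb
  have hfa : ∀ x, f x ≤ a := le_iSup f
  have hgb : ∀ x, g x ≤ b := le_iSup g
  rcases eq_or_ne a 0 with ha0 | ha0
  · have : ∀ x, f x = 0 := fun x => le_zero_iff.1 (ha0 ▸ hfa x)
    simp [this, hp]
  rcases eq_or_ne b 0 with hb0 | hb0
  · have : ∀ x, g x = 0 := fun x => le_zero_iff.1 (hb0 ▸ hgb x)
    simp [this, hq]
  set c := a ^ p * b ^ q with hc
  have hc0 : c ≠ 0 := by simp [c, ha0, hb0, hftop, hgtop]
  have hctop : c ≠ ∞ := by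
    simp [c, ENNReal.mul_eq_top, ha0, hb0, hftop, hgtop]
  have hf1 (x) : f x / a ≤ 1 := ENNReal.div_le_of_le_mul (by simpa using hfa x)
  have hg1 (x) : g x / b ≤ 1 := ENNReal.div_le_of_le_mul (by simpa using hgb x)
  have hfne (x) : f x / a ≠ ∞ := ((hf1 x).trans_lt ENNReal.one_lt_top).ne
  have hgne (x) : g x / b ≠ ∞ := ((hg1 x).trans_lt ENNReal.one_lt_top).ne
  have hhne (x) : min (h x / c) 1 ≠ ∞ := ((min_le_right _ _).trans_lt ENNReal.one_lt_top).ne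
  have hsup {F : ℝ → ℝ≥0∞} {d : ℝ≥0∞} (hd : d = ⨆ x, F x) (hd0 : d ≠ 0) (hdtop : d ≠ ∞)
      (hFne : ∀ x, F x / d ≠ ∞) (u : ℝ) (hu0 : 0 < u) (hu : u < 1) : ∃ x, u < (F x / d).toReal := by
    have hlt : ENNReal.ofReal u * d < ⨆ x, F x := by
      rw [← hd]
      calc ENNReal.ofReal u * d < 1 * d :=
            ENNReal.mul_lt_mul_left hd0 hdtop (by simpa using hu)
        _ = d := one_mul d
    obtain ⟨x, hx⟩ := lt_iSup_iff.1 hlt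
    exact ⟨x, (ENNReal.ofReal_lt_iff_lt_toReal hu0.le (hFne x)).1
      ((ENNReal.lt_div_iff_mul_lt (.inl hd0) (.inl hdtop)).2 hx)⟩
  have hdiv (x y : ℝ≥0∞) : (x / a) ^ p * (y / b) ^ q = x ^ p * y ^ q / c := by
    rw [ENNReal.div_rpow_of_nonneg _ _ hp.le, ENNReal.div_rpow_of_nonneg _ _ hq.le, hc,
      ENNReal.mul_div_mul_comm (by simp [hgtop, hq.le]) (by simp [hb0, hgtop])]
  have key := Real.lintegral_ofReal_add_le hp hq (f := fun x => (f x / a).toReal)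
    (g := fun x => (g x / b).toReal) (h := fun x => (min (h x / c) 1).toReal)
    (by fun_prop) (by fun_prop) (by fun_prop) (fun x => ENNReal.toReal_nonneg)
    (fun x => ENNReal.toReal_nonneg) (fun x => ENNReal.toReal_nonneg)
    (fun x => ENNReal.toReal_le_of_le_ofReal zero_le_one (by simpa using hf1 x))
    (fun x => ENNReal.toReal_le_of_le_ofReal zero_le_one (by simpa using hg1 x))
    (hsup ha ha0 hftop hfne) (hsup hb hb0 hgtop hgne) ?_
  · simp only [ENNReal.ofReal_toReal (hfne _), ENNReal.ofReal_toReal (hgne _),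
      ENNReal.ofReal_toReal (hhne _)] at key
    have hle : (∫⁻ x, f x / a) ^ p * (∫⁻ x, g x / b) ^ q ≤ ∫⁻ x, h x / c :=
      (ENNReal.geom_mean_le_arith_mean2 hp hq hpq _ _).trans <|
        key.trans <| lintegral_mono fun x => min_le_left _ _
    have hconst {F : ℝ → ℝ≥0∞} (hF : Measurable F) (d : ℝ≥0∞) :
        ∫⁻ x, F x / d = (∫⁻ x, F x) / d := by
      simp only [div_eq_mul_inv, lintegral_mul_const _ hF]
    rw [hconst hf, hconst hg, hconst hh, hdiv] at hle
    rwa [ENNReal.div_le_iff hc0 hctop, ENNReal.div_mul_cancel hc0 hctop] at hle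
  · intro x y u hu hfx hgy
    rw [← ENNReal.ofReal_lt_iff_lt_toReal hu.le (hfne x)] at hfx
    rw [← ENNReal.ofReal_lt_iff_lt_toReal hu.le (hgne y)] at hgy
    rw [← ENNReal.ofReal_lt_iff_lt_toReal hu.le (hhne _)]
    refine lt_min ?_ (hfx.trans_le (hf1 x))
    calc ENNReal.ofReal u = ENNReal.ofReal u ^ p * ENNReal.ofReal u ^ q := by
          rw [← ENNReal.rpow_add_of_nonneg _ _ hp.le hq.le, hpq, ENNReal.rpow_one]
      _ < (f x / a) ^ p * (g y / b) ^ q :=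
          ENNReal.mul_lt_mul (ENNReal.rpow_lt_rpow hfx hp) (ENNReal.rpow_lt_rpow hgy hq)
      _ = f x ^ p * g y ^ q / c := hdiv _ _
      _ ≤ h (p * x + q * y) / c := by gcongr; exact hfgh x y

theorem Real.prekopaLeindler {p q : ℝ} (hp : 0 < p) (hq : 0 < q) (hpq : p + q = 1)
    {f g h : ℝ → ℝ≥0∞} (hf : Measurable f) (hg : Measurable g) (hh : Measurable h)
    (hfgh : ∀ x y, f x ^ p * g y ^ q ≤ h (p * x + q * y)) :
    (∫⁻ x, f x) ^ p * (∫⁻ x, g x) ^ q ≤ ∫⁻ x, h x := by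
  have htrunc {F : ℝ → ℝ≥0∞} (hF : Measurable F) :
      ∫⁻ x, F x = ⨆ k : ℕ, ∫⁻ x, min (F x) k := by
    rw [← lintegral_iSup (f := fun (k : ℕ) x => min (F x) k) (fun k => by fun_prop)
      fun i j hij x => min_le_min le_rfl (by exact_mod_cast hij)]
    simp [← inf_iSup_eq, ENNReal.iSup_natCast]
  have hrpow {r : ℝ} (hr : 0 < r) (u : ℕ → ℝ≥0∞) : (⨆ k, u k) ^ r = ⨆ k, u k ^ r :=
    (ENNReal.orderIsoRpow r hr).map_iSup u
  have hne (F : ℝ → ℝ≥0∞) (k : ℕ) : ⨆ x, min (F x) k ≠ ∞ :=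
    ((iSup_le fun x => min_le_right _ _).trans_lt (ENNReal.natCast_lt_top k)).ne
  rw [htrunc hf, htrunc hg, hrpow hp, hrpow hq]
  simp only [ENNReal.iSup_mul, ENNReal.mul_iSup, iSup_le_iff]
  intro i j
  refine Real.prekopaLeindler_of_bounded hp hq hpq (by fun_prop) (by fun_prop) hh (hne f _)
    (hne g _) fun x y => le_trans ?_ (hfgh x y)
  gcongr <;> exact min_le_left _ _

/-- The **Prékopa–Leindler inequality**. -/
theorem prekopaLeindler {p q : ℝ} (hp : 0 < p) (hq : 0 < q) (hpq : p + q = 1) {n : ℕ}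
    {f g h : (Fin n → ℝ) → ℝ≥0∞} (hf : Measurable f) (hg : Measurable g) (hh : Measurable h)
    (hfgh : ∀ x y, f x ^ p * g y ^ q ≤ h (p • x + q • y)) :
    (∫⁻ x, f x) ^ p * (∫⁻ x, g x) ^ q ≤ ∫⁻ x, h x := by
  induction n with
  | zero =>
    simp only [lintegral_unique, volume_pi, Measure.pi_univ, Finset.univ_eq_empty,
      Finset.prod_empty, mul_one]
    exact (hfgh _ _).trans_eq (congrArg h (Subsingleton.elim _ _))
  | succ n ih =>
    have hcons : Measurable fun z : ℝ × (Fin n → ℝ) => (Fin.cons z.1 z.2 : Fin (n + 1) → ℝ) := by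
      refine measurable_pi_lambda _ fun i => ?_
      refine Fin.cases ?_ (fun j => ?_) i
      · simpa using measurable_fst
      · simp only [Fin.cons_succ]; fun_prop
    have hfubini {F : (Fin (n + 1) → ℝ) → ℝ≥0∞} (hF : Measurable F) :
        ∫⁻ x, F x = ∫⁻ t : ℝ, ∫⁻ y : Fin n → ℝ, F (Fin.cons t y) := by
      rw [← (volume_preserving_piFinSuccAbove (fun _ : Fin (n + 1) => ℝ) 0).symm.lintegral_comp hF,
        Measure.volume_eq_prod, lintegral_prod _ (by fun_prop)]
      simp [MeasurableEquiv.piFinSuccAbove_symm_apply, Fin.insertNthEquiv]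
    rw [hfubini hf, hfubini hg, hfubini hh]
    refine Real.prekopaLeindler hp hq hpq (hf.comp hcons).lintegral_prod_right'
      (hg.comp hcons).lintegral_prod_right' (hh.comp hcons).lintegral_prod_right' fun s t => ?_
    refine ih (hf.comp (hcons.comp measurable_prodMk_left))
      (hg.comp (hcons.comp measurable_prodMk_left)) (hh.comp (hcons.comp measurable_prodMk_left))
      fun x y => (hfgh _ _).trans_eq (congrArg h ?_)
    ext i
    refine Fin.cases ?_ (fun j => ?_) i <;> simp

/-- The multiplicative form of the **Brunn–Minkowski inequality**. -/
theorem EuclideanSpace.volume_rpow_mul_volume_rpow_le {p q : ℝ} (hp : 0 < p) (hq : 0 < q)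
    (hpq : p + q = 1) {s : ℕ} {A B C : Set (EuclideanSpace ℝ (Fin s))} (hA : MeasurableSet A)
    (hB : MeasurableSet B) (hC : MeasurableSet C) (h : ∀ x ∈ A, ∀ y ∈ B, p • x + q • y ∈ C) :
    volume A ^ p * volume B ^ q ≤ volume C := by
  have hmp := PiLp.volume_preserving_toLp (Fin s)
  have hvol {D : Set (EuclideanSpace ℝ (Fin s))} (hD : MeasurableSet D) :
      volume D = ∫⁻ x, (WithLp.toLp 2 ⁻¹' D).indicator 1 x := by
    rw [lintegral_indicator_one (hmp.measurable hD), hmp.measure_preimage hD.nullMeasurableSet]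
  have hmeas {D : Set (EuclideanSpace ℝ (Fin s))} (hD : MeasurableSet D) :
      Measurable ((WithLp.toLp 2 ⁻¹' D).indicator (1 : (Fin s → ℝ) → ℝ≥0∞)) :=
    measurable_one.indicator (hmp.measurable hD)
  rw [hvol hA, hvol hB, hvol hC]
  refine prekopaLeindler hp hq hpq (hmeas hA) (hmeas hB) (hmeas hC) fun x y => ?_
  by_cases hx : WithLp.toLp 2 x ∈ A
  · by_cases hy : WithLp.toLp 2 y ∈ B
    · have hxy : WithLp.toLp 2 (p • x + q • y) ∈ C := h _ hx _ hy
      simp only [Set.indicator, Set.mem_preimage, hx, hy, hxy]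
      simp
    · simp [Set.indicator, hy, hq]
  · simp [Set.indicator, hx, hp]

theorem EuclideanSpace.mul_volume_real_rpow_le_of_nonempty {b : ℝ} (hb : 0 < b) {s : ℕ}
    (hs : s ≠ 0) {B C : Set (EuclideanSpace ℝ (Fin s))} (hCfin : volume C ≠ ∞)
    (z : EuclideanSpace ℝ (Fin s)) (h : ∀ y ∈ B, z + b • y ∈ C) :
    b * volume.real B ^ (1 / (s : ℝ)) ≤ volume.real C ^ (1 / (s : ℝ)) := by
  have hle : volume.real ((z + ·) '' (b • B)) ≤ volume.real C := by
    refine measureReal_mono ?_ hCfin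
    rintro _ ⟨_, ⟨y, hy, rfl⟩, rfl⟩
    exact h y hy
  have hvol : volume.real ((z + ·) '' (b • B)) = b ^ s * volume.real B := by
    simp [measureReal_def, Measure.addHaar_smul, abs_of_pos hb, hb.le]
  rw [hvol] at hle
  calc b * volume.real B ^ (1 / (s : ℝ)) = (b ^ s * volume.real B) ^ (1 / (s : ℝ)) := by
        rw [Real.mul_rpow (by positivity) (by positivity), one_div,
          Real.pow_rpow_inv_natCast hb.le hs]
    _ ≤ _ := by gcongr

/-- The **Brunn–Minkowski inequality**. -/
theorem EuclideanSpace.brunnMinkowski {a b : ℝ} (ha : 0 < a) (hb : 0 < b)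
    {s : ℕ} (hs : s ≠ 0) {A B C : Set (EuclideanSpace ℝ (Fin s))}
    (hA : MeasurableSet A) (hB : MeasurableSet B) (hC : MeasurableSet C)
    (hA' : A.Nonempty) (hB' : B.Nonempty)
    (hCfin : volume C ≠ ∞) (h : ∀ x ∈ A, ∀ y ∈ B, a • x + b • y ∈ C) :
    a * volume.real A ^ (1 / (s : ℝ)) + b * volume.real B ^ (1 / (s : ℝ)) ≤
      volume.real C ^ (1 / (s : ℝ)) := by
  obtain ⟨x, hx⟩ := hA'
  obtain ⟨y, hy⟩ := hB'
  rcases (measureReal_nonneg : 0 ≤ volume.real A).eq_or_lt' with hA0 | hA0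
  · simpa [hA0, hs] using mul_volume_real_rpow_le_of_nonempty hb hs hCfin (a • x) (h x hx)
  rcases (measureReal_nonneg : 0 ≤ volume.real B).eq_or_lt' with hB0 | hB0
  · simpa [hB0, hs] using mul_volume_real_rpow_le_of_nonempty ha hs hCfin (b • y)
      fun x hx => add_comm (a • x) (b • y) ▸ h x hx y hy
  set α := volume.real A ^ (1 / (s : ℝ))
  set β := volume.real B ^ (1 / (s : ℝ))
  have hα0 : 0 < α := Real.rpow_pos_of_pos hA0 _
  have hβ0 : 0 < β := Real.rpow_pos_of_pos hB0 _
  set M := a * α + b * β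
  have hM0 : 0 < M := by positivity
  have hsmul {c : ℝ} (hc : 0 < c) (D : Set (EuclideanSpace ℝ (Fin s))) :
      volume (c⁻¹ • D) = ENNReal.ofReal (c ^ s)⁻¹ * volume D := by
    simp [Measure.addHaar_smul, abs_of_pos hc]
  have hone {D : Set (EuclideanSpace ℝ (Fin s))} (hD : 0 < volume.real D) :
      volume ((volume.real D ^ (1 / (s : ℝ)))⁻¹ • D) = 1 := by
    rw [hsmul (Real.rpow_pos_of_pos hD _), one_div, Real.rpow_inv_natCast_pow hD.le hs,
      ENNReal.ofReal_inv_of_pos hD, ofReal_measureReal (ENNReal.toReal_pos_iff.1 hD).2.ne]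
    exact ENNReal.inv_mul_cancel (ENNReal.toReal_pos_iff.1 hD).1.ne'
      (ENNReal.toReal_pos_iff.1 hD).2.ne
  have key := volume_rpow_mul_volume_rpow_le (p := a * α / M) (q := b * β / M) (by positivity)
    (by positivity) (by rw [← add_div, div_self hM0.ne']) (hA.const_smul₀ α⁻¹)
    (hB.const_smul₀ β⁻¹) (hC.const_smul₀ M⁻¹) (by
      rintro _ ⟨x, hx, rfl⟩ _ ⟨y, hy, rfl⟩
      refine ⟨_, h x hx y hy, ?_⟩
      simp only [smul_add, smul_smul]
      congr 2 <;> field_simp)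
  rw [hone hA0, hone hB0, hsmul hM0, ENNReal.one_rpow, ENNReal.one_rpow, one_mul,
    ← ofReal_measureReal hCfin, ← ENNReal.ofReal_mul (by positivity), ENNReal.one_le_ofReal,
    inv_mul_eq_div, one_le_div (by positivity)] at key
  calc M = (M ^ s) ^ (1 / (s : ℝ)) := by rw [one_div, Real.pow_rpow_inv_natCast hM0.le hs]
    _ ≤ _ := by gcongr

/-- The **Brunn–Minkowski inequality** for bounded convex sets. -/
theorem Convex.brunnMinkowski {a b : ℝ} (ha : 0 < a) (hb : 0 < b)
    {s : ℕ} (hs : s ≠ 0) {A B C : Set (EuclideanSpace ℝ (Fin s))}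
    (hA : Convex ℝ A) (hB : Convex ℝ B) (hC : Convex ℝ C) (hA' : A.Nonempty) (hB' : B.Nonempty)
    (hCb : Bornology.IsBounded C) (h : ∀ x ∈ A, ∀ y ∈ B, a • x + b • y ∈ C) :
    a * volume.real A ^ (1 / (s : ℝ)) + b * volume.real B ^ (1 / (s : ℝ)) ≤
      volume.real C ^ (1 / (s : ℝ)) := by
  have hclosure {D : Set (EuclideanSpace ℝ (Fin s))} (hD : Convex ℝ D) :
      volume.real D = volume.real (closure D) := by
    rw [measureReal_def, measureReal_def,
      measure_closure_of_null_frontier (hD.addHaar_frontier volume)]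
  rw [hclosure hA, hclosure hB, hclosure hC]
  exact EuclideanSpace.brunnMinkowski ha hb hs isClosed_closure.measurableSet
    isClosed_closure.measurableSet isClosed_closure.measurableSet hA'.closure hB'.closure
    hCb.closure.measure_lt_top.ne fun x hx y hy =>
      map_mem_closure₂ (f := fun x y => a • x + b • y) (by fun_prop) hx hy h

/-- **The Steiner-type symmetrization `S` preserves convexity.** If `C ⊂ ℝⁿ × ℝˢ` is a
bounded convex set, then `S(C)` is convex. -/
theorem Ssymm_convex (n s : ℕ) (hn : 0 < n) (hs : 0 < s)
    (C : Set (EuclideanSpace ℝ (Fin n) × EuclideanSpace ℝ (Fin s)))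
    (hCb : Bornology.IsBounded C) (hCc : Convex ℝ C) :
    Convex ℝ (Ssymm n s C) := by
  rw [convex_iff_forall_pos]
  rintro ⟨x₁, y₁⟩ ⟨hne₁, hle₁⟩ ⟨x₂, y₂⟩ ⟨hne₂, hle₂⟩ a b ha hb hab
  have hsection (x : EuclideanSpace ℝ (Fin n)) : Convex ℝ {y | (x, y) ∈ C} := by
    intro y hy z hz c d hc hd hcd
    simpa [← add_smul, hcd] using hCc hy hz hc hd hcd
  have hmem : ∀ y ∈ {y | (x₁, y) ∈ C}, ∀ z ∈ {y | (x₂, y) ∈ C},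
      a • y + b • z ∈ {y | (a • x₁ + b • x₂, y) ∈ C} :=
    fun y hy z hz => hCc hy hz ha.le hb.le hab
  have hbdd : Bornology.IsBounded {y | (a • x₁ + b • x₂, y) ∈ C} :=
    hCb.image_snd.subset fun y hy => ⟨_, hy, rfl⟩
  have hradius : a * sectionRadius n s C x₁ + b * sectionRadius n s C x₂ ≤
      sectionRadius n s C (a • x₁ + b • x₂) := by
    have hω : 0 ≤ (unitBallVol s)⁻¹ := inv_nonneg.2 ENNReal.toReal_nonneg
    have hBM := Convex.brunnMinkowski ha hb hs.ne' (hsection x₁) (hsection x₂) (hsection _)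
      hne₁ hne₂ hbdd hmem
    simp only [sectionRadius, Real.mul_rpow hω ENNReal.toReal_nonneg]
    simp only [measureReal_def] at hBM
    nlinarith [mul_le_mul_of_nonneg_left hBM (Real.rpow_nonneg hω (1 / (s : ℝ)))]
  obtain ⟨y, hy⟩ := hne₁
  obtain ⟨z, hz⟩ := hne₂
  refine ⟨⟨_, hmem y hy z hz⟩, ?_⟩
  calc ‖a • y₁ + b • y₂‖ ≤ a * ‖y₁‖ + b * ‖y₂‖ := by
        refine (norm_add_le _ _).trans_eq ?_
        rw [norm_smul, norm_smul, Real.norm_of_nonneg ha.le, Real.norm_of_nonneg hb.le]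
    _ ≤ a * sectionRadius n s C x₁ + b * sectionRadius n s C x₂ := by gcongr
    _ ≤ _ := hradius
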